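/- There exists a universal constant C > 0 such that the following holds for every integer d ≥ 1 and every α, γ with 0 < α < γ ≤ 1/600. There exists a set 𝒞 of d-dimensional Gaussians (pairs (μ, Σ) with μ ∈ ℝ^d and Σ positive definite) such that: (i) for every μ̂ ∈ ℝ^d and positive definite Σ̂ there exists (μ', Σ') ∈ 𝒞 with dTV(N(μ̂, Σ̂), N(μ', Σ')) ≤ α, and (ii) for every μ̂ ∈ ℝ^d and positive definite Σ̂, the set {(μ', Σ') ∈ 𝒞 : dTV(N(μ̂, Σ̂), N(μ', Σ')) ≤ γ} has at most (2γ/α)^{C·d²} elements. -/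

import Mathlib

open MeasureTheory Matrix

/-- Total variation distance between two measures:
`dTV(μ,ν) = sup` over measurable sets `A` of `|μ(A) − ν(A)|`. -/
noncomputable def tvDist {Ω : Type*} [MeasurableSpace Ω] (μ ν : Measure Ω) : ℝ :=
  ⨆ A : {A : Set Ω // MeasurableSet A}, |(μ A).toReal - (ν A).toReal|

/-- The multivariate Gaussian measure `N(μ, Σ)` on `ℝ^d`, given by its density
w.r.t. the Lebesgue measure. -/
noncomputable def gaussianMeasure (d : ℕ) (μ : Fin d → ℝ)
    (S : Matrix (Fin d) (Fin d) ℝ) : Measure (Fin d → ℝ) :=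
  volume.withDensity fun x =>
    ENNReal.ofReal ((Real.sqrt ((2 * Real.pi) ^ d * S.det))⁻¹ *
      Real.exp (-(1 / 2) * ((fun i => x i - μ i) ⬝ᵥ S⁻¹.mulVec (fun i => x i - μ i))))


open scoped NNReal
open ProbabilityTheory Complex in
/-- Integral of a pure quadratic-and-linear phase against a one-dimensional Gaussian density,
in polar form. -/
theorem integral_gaussianPDFReal_mul_cexp_linear (m : ℝ) (v : ℝ≥0) (hv : v ≠ 0) (u : ℝ) :
    ∫ x : ℝ, (gaussianPDFReal m v x : ℂ) * cexp (I * (u * x : ℝ)) =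
      cexp ((-(u ^ 2 * v / 2) : ℝ) + (u * m : ℝ) * I) := by
  have := charFun_gaussianReal (μ := m) (v := v) u
  rw [charFun_apply_real, integral_gaussianReal_eq_integral_smul hv] at this
  convert this using 1
  · congr 1; ext x
    simp only [real_smul]
    congr 2; push_cast; ring
  · congr 1; push_cast; ring

open Complex in
theorem cpow_half_polar (c y : ℝ) (hc : 0 < c) :
    ((c : ℂ) / (1 - y * I)) ^ (1 / 2 : ℂ) =
      (√c : ℂ) * cexp ((-(Real.log (1 + y ^ 2) / 4) : ℝ) + (Real.arctan y / 2 : ℝ) * I) := by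
  have h1 : 0 < 1 + y ^ 2 := by positivity
  have hne : (1 - y * I : ℂ) ≠ 0 := by
    intro h
    have := congrArg Complex.re h
    simp at this
  have key : ((c : ℂ) / (1 - y * I)) =
      cexp ((Real.log c - Real.log (1 + y ^ 2) / 2 : ℝ) + (Real.arctan y : ℝ) * I) := by
    rw [Complex.exp_add, Complex.exp_mul_I, ← Complex.ofReal_exp, ← Complex.ofReal_cos,
      ← Complex.ofReal_sin, Real.cos_arctan, Real.sin_arctan, Real.exp_sub, Real.exp_log hc,
      ← Real.log_sqrt h1.le, Real.exp_log (Real.sqrt_pos.2 h1), div_eq_iff hne]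
    have hs : (√(1 + y ^ 2)) ≠ 0 := (Real.sqrt_pos.2 h1).ne'
    have hs2 : ((√(1 + y ^ 2) : ℝ) : ℂ) ^ 2 = 1 + y ^ 2 := by
      rw [← Complex.ofReal_pow, Real.sq_sqrt h1.le]; push_cast; ring
    have hs' : ((√(1 + y ^ 2) : ℝ) : ℂ) ≠ 0 := by exact_mod_cast hs
    push_cast
    field_simp
    rw [hs2]
    linear_combination (c : ℂ) * (y : ℂ) ^ 2 * (Complex.I_sq)
  rw [key, Complex.cpow_def_of_ne_zero (Complex.exp_ne_zero _), Complex.log_exp]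
  · have : (√c : ℂ) = cexp (Real.log c / 2 : ℝ) := by
      rw [← Complex.ofReal_exp, ← Real.log_sqrt hc.le, Real.exp_log (Real.sqrt_pos.2 hc)]
    rw [this, ← Complex.exp_add]
    congr 1
    push_cast
    ring
  · have := Real.neg_pi_div_two_lt_arctan y
    simp only [add_im, ofReal_im, mul_im, ofReal_re, I_im, I_re, mul_one, mul_zero, add_zero,
      zero_add]
    linarith [Real.pi_pos]
  · have := Real.arctan_lt_pi_div_two y
    simp only [add_im, ofReal_im, mul_im, ofReal_re, I_im, I_re, mul_one, mul_zero, add_zero,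
      zero_add]
    linarith [Real.pi_pos]

open ProbabilityTheory Complex in
theorem integral_gaussianPDFReal_mul_cexp_quadratic (m : ℝ) (v : ℝ≥0) (hv : v ≠ 0) (b : ℝ) :
    ∫ x : ℝ, (gaussianPDFReal m v x : ℂ) * cexp (I * (b * x ^ 2 : ℝ)) =
      cexp ((-(Real.log (1 + (2 * b * v) ^ 2) / 4) -
          2 * b ^ 2 * v * m ^ 2 / (1 + (2 * b * v) ^ 2) : ℝ) +
        (Real.arctan (2 * b * v) / 2 + b * m ^ 2 / (1 + (2 * b * v) ^ 2) : ℝ) * I) := by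
  have hv0 : (0 : ℝ) < v := by positivity
  have hvc : (v : ℂ) ≠ 0 := by exact_mod_cast hv
  set B : ℂ := -(1 / (2 * v)) + I * b with hB
  have hre : B.re < 0 := by
    have : B = ((-(1 / (2 * v)) : ℝ) : ℂ) + (b : ℂ) * I := by rw [hB]; push_cast; ring
    rw [this]; simp [hv0]
  have hpoint : ∀ x : ℝ, (gaussianPDFReal m v x : ℂ) * cexp (I * (b * x ^ 2 : ℝ)) =
      ((√(2 * Real.pi * v))⁻¹ : ℝ) *
        cexp (B * x ^ 2 + (m / v : ℂ) * x + (-(m ^ 2 / (2 * v)) : ℂ)) := by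
    intro x
    rw [gaussianPDFReal]
    push_cast
    rw [mul_assoc, ← Complex.exp_add]
    congr 2
    rw [hB]; field_simp; ring
  simp_rw [hpoint]
  rw [integral_const_mul, integral_cexp_quadratic hre]
  have h1 : (1 - ((2 * b * v : ℝ) : ℂ) * I) ≠ 0 := by
    intro h
    have := congrArg Complex.re h
    simp at this
  have h1' : (1 + (2 * b * v : ℂ) ^ 2) ≠ 0 := by
    have : (0 : ℝ) < (1 + (2 * b * v) ^ 2) := by positivity
    exact_mod_cast this.ne'
  have hB2 : B = -((1 - ((2 * b * v : ℝ) : ℂ) * I) / (2 * v)) := by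
    rw [hB]; push_cast; field_simp; ring
  have hpi : (Real.pi : ℂ) / -B = ((2 * Real.pi * v : ℝ) : ℂ) / (1 - ((2 * b * v : ℝ) : ℂ) * I) := by
    rw [hB2, neg_neg]; push_cast
    push_cast at h1
    field_simp
  have hc : 0 < 2 * Real.pi * (v : ℝ) := by positivity
  rw [hpi, cpow_half_polar _ _ hc, ← mul_assoc, ← mul_assoc]
  have h2 : (((√(2 * Real.pi * v))⁻¹ : ℝ) : ℂ) * (√(2 * Real.pi * v) : ℂ) = 1 := by
    rw [← Complex.ofReal_mul, inv_mul_cancel₀ (Real.sqrt_pos.2 hc).ne', Complex.ofReal_one]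
  rw [h2, one_mul, ← Complex.exp_add]
  congr 1
  have h3 : -(m ^ 2 / (2 * v) : ℂ) - (m / v : ℂ) ^ 2 / (4 * B) =
      (I * b * m ^ 2) / (1 - ((2 * b * v : ℝ) : ℂ) * I) := by
    rw [hB2]
    generalize hD : (1 - ((2 * b * v : ℝ) : ℂ) * I) = D at h1
    field_simp
    push_cast at hD
    linear_combination (4 * m ^ 2 : ℂ) * hD
  have h4 : (I * b * m ^ 2) / (1 - ((2 * b * v : ℝ) : ℂ) * I) =
      (I * b * m ^ 2) * (1 + 2 * b * v * I) / (1 + (2 * b * v : ℂ) ^ 2) := by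
    rw [div_eq_div_iff h1 h1']
    push_cast
    linear_combination (I * b * m ^ 2) * (2 * b * v) ^ 2 * I_sq
  rw [h3, h4]
  push_cast
  linear_combination (2 * b ^ 2 * m ^ 2 * v / (1 + (2 * b * v) ^ 2) : ℂ) * I_sq

open Complex in
theorem exp_mul_abs_sin_le_norm_sub (r₁ r₂ θ₁ θ₂ : ℝ) :
    Real.exp r₁ * |Real.sin (θ₂ - θ₁)| ≤
      ‖cexp (r₁ + θ₁ * I) - cexp (r₂ + θ₂ * I)‖ := by
  have h : cexp (r₁ + θ₁ * I) - cexp (r₂ + θ₂ * I) =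
      (cexp (r₁ + (θ₁ - θ₂ : ℝ) * I) - cexp r₂) * cexp (θ₂ * I) := by
    rw [sub_mul, ← Complex.exp_add, ← Complex.exp_add]
    congr 2; push_cast; ring
  rw [h, norm_mul, Complex.norm_exp_ofReal_mul_I, mul_one]
  refine le_trans (le_of_eq ?_) (Complex.abs_im_le_norm _)
  rw [sub_im, Complex.exp_ofReal_im, sub_zero, Complex.exp_im]
  simp only [add_re, add_im, ofReal_re, ofReal_im, mul_re, mul_im, I_re, I_im]
  rw [abs_mul, abs_of_pos (Real.exp_pos _), ← abs_neg, ← Real.sin_neg]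
  simp

section Product

variable {ι : Type*} [Fintype ι]

open ProbabilityTheory

theorem integrable_prod_gaussianPDFReal (m : ι → ℝ) (v : ι → ℝ≥0) :
    Integrable (fun x : ι → ℝ => ∏ j, gaussianPDFReal (m j) (v j) (x j)) :=
  Integrable.fintype_prod_dep fun j => integrable_gaussianPDFReal (m j) (v j)

theorem integral_prod_gaussianPDFReal (m : ι → ℝ) (v : ι → ℝ≥0) (hv : ∀ j, v j ≠ 0) :
    ∫ x : ι → ℝ, ∏ j, gaussianPDFReal (m j) (v j) (x j) = 1 := by
  rw [integral_fintype_prod_volume_eq_prod fun j => gaussianPDFReal (m j) (v j)]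
  exact Finset.prod_eq_one fun j _ => integral_gaussianPDFReal_eq_one (m j) (hv j)

theorem norm_integral_mul_sub_le {Ω : Type*} [MeasurableSpace Ω] {μ : Measure Ω} {p q : Ω → ℝ}
    {f : Ω → ℂ} (hp : Integrable p μ) (hq : Integrable q μ) (hf : AEStronglyMeasurable f μ)
    (hf1 : ∀ x, ‖f x‖ ≤ 1) :
    ‖∫ x, (p x : ℂ) * f x ∂μ - ∫ x, (q x : ℂ) * f x ∂μ‖ ≤ ∫ x, |p x - q x| ∂μ := by
  have h1 : Integrable (fun x => (p x : ℂ) * f x) μ :=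
    hp.ofReal.mul_bdd (c := 1) hf (Filter.Eventually.of_forall hf1)
  have h2 : Integrable (fun x => (q x : ℂ) * f x) μ :=
    hq.ofReal.mul_bdd (c := 1) hf (Filter.Eventually.of_forall hf1)
  rw [← integral_sub h1 h2]
  refine norm_integral_le_of_norm_le (hp.sub hq).abs (Filter.Eventually.of_forall fun x => ?_)
  rw [← sub_mul, norm_mul, ← Complex.ofReal_sub, Complex.norm_real, Real.norm_eq_abs]
  exact mul_le_of_le_one_right (abs_nonneg _) (hf1 x)

/-- Testing two product Gaussian densities against a product of one-dimensional phases. -/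
theorem exp_sum_mul_abs_sin_le (m m' : ι → ℝ) (v v' : ι → ℝ≥0) (φ : ι → ℝ → ℝ)
    (hφ : ∀ j, Continuous (φ j)) (r r' θ θ' : ι → ℝ)
    (h : ∀ j, ∫ x : ℝ, (gaussianPDFReal (m j) (v j) x : ℂ) * Complex.exp (Complex.I * φ j x) =
      Complex.exp (r j + θ j * Complex.I))
    (h' : ∀ j, ∫ x : ℝ, (gaussianPDFReal (m' j) (v' j) x : ℂ) * Complex.exp (Complex.I * φ j x) =
      Complex.exp (r' j + θ' j * Complex.I)) :
    Real.exp (∑ j, r j) * |Real.sin (∑ j, (θ' j - θ j))| ≤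
      ∫ x : ι → ℝ, |∏ j, gaussianPDFReal (m j) (v j) (x j) -
        ∏ j, gaussianPDFReal (m' j) (v' j) (x j)| := by
  have key : ∀ (m : ι → ℝ) (v : ι → ℝ≥0) (r θ : ι → ℝ)
      (_ : ∀ j, ∫ x : ℝ, (gaussianPDFReal (m j) (v j) x : ℂ) *
        Complex.exp (Complex.I * φ j x) = Complex.exp (r j + θ j * Complex.I)),
      ∫ x : ι → ℝ, ((∏ j, gaussianPDFReal (m j) (v j) (x j) : ℝ) : ℂ) *
        Complex.exp (Complex.I * (∑ j, φ j (x j) : ℝ)) =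
      Complex.exp ((∑ j, r j : ℝ) + (∑ j, θ j : ℝ) * Complex.I) := by
    intro m v r θ h
    calc _ = ∫ x : ι → ℝ, ∏ j, ((gaussianPDFReal (m j) (v j) (x j) : ℂ) *
              Complex.exp (Complex.I * φ j (x j))) := by
            congr 1; ext x
            rw [Finset.prod_mul_distrib, ← Complex.exp_sum, ← Finset.mul_sum]
            push_cast
            rfl
      _ = _ := by
            rw [integral_fintype_prod_volume_eq_prod fun j y =>
              (gaussianPDFReal (m j) (v j) y : ℂ) * Complex.exp (Complex.I * φ j y)]
            simp_rw [h]
            rw [← Complex.exp_sum, Finset.sum_add_distrib, ← Finset.sum_mul]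
            push_cast
            rfl
  rw [Finset.sum_sub_distrib]
  refine (exp_mul_abs_sin_le_norm_sub _ (∑ j, r' j) _ _).trans ?_
  rw [← key m v r θ h, ← key m' v' r' θ' h']
  refine norm_integral_mul_sub_le (integrable_prod_gaussianPDFReal m v)
    (integrable_prod_gaussianPDFReal m' v') ?_ fun x => ?_
  · refine Continuous.aestronglyMeasurable ?_
    fun_prop
  · rw [mul_comm, Complex.norm_exp_ofReal_mul_I]

theorem mean_le_of_integral_abs_sub_le (m : ι → ℝ) (v : ι → ℝ≥0) (hv : ∀ j, v j ≠ 0) (ε : ℝ)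
    (hε : ε ≤ 1 / 300)
    (h : ∫ x : ι → ℝ, |∏ j, gaussianPDFReal 0 1 (x j) -
        ∏ j, gaussianPDFReal (m j) (v j) (x j)| ≤ ε) :
    √(∑ j, m j ^ 2) ≤ 3 * ε := by
  set M := √(∑ j, m j ^ 2) with hM
  have hM2 : ∑ j, m j ^ 2 = M ^ 2 := (Real.sq_sqrt (by positivity)).symm
  have hM0 : 0 ≤ M := Real.sqrt_nonneg _
  have hε0 : 0 ≤ ε := le_trans (by positivity) h
  rcases hM0.eq_or_lt with h0 | hpos
  · rw [← h0]; positivity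
  set t := min 1 M⁻¹ with ht
  have ht0 : 0 < t := lt_min one_pos (inv_pos.2 hpos)
  have ht1 : t ≤ 1 := min_le_left _ _
  have htM : t * M ≤ 1 := by
    calc t * M ≤ M⁻¹ * M := by gcongr; exact min_le_right _ _
      _ = 1 := inv_mul_cancel₀ hpos.ne'
  have key := exp_sum_mul_abs_sin_le (fun _ => 0) m (fun _ => 1) v
    (fun j x => (t / M * m j) * x) (fun j => by fun_prop) _ _ _ _
    (fun j => integral_gaussianPDFReal_mul_cexp_linear 0 1 one_ne_zero (t / M * m j))
    (fun j => integral_gaussianPDFReal_mul_cexp_linear (m j) (v j) (hv j) (t / M * m j))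
  have e1 : ∑ j, -((t / M * m j) ^ 2 * ((1 : ℝ≥0) : ℝ) / 2) = -(t ^ 2 / 2) := by
    have : ∀ j, -((t / M * m j) ^ 2 * ((1 : ℝ≥0) : ℝ) / 2) = -((t / M) ^ 2 / 2) * m j ^ 2 := by
      intro j; push_cast; ring
    simp_rw [this]
    rw [← Finset.mul_sum, hM2]
    field_simp
  have e2 : ∑ j, ((t / M * m j) * m j - (t / M * m j) * 0) = t * M := by
    have : ∀ j, ((t / M * m j) * m j - (t / M * m j) * 0) = (t / M) * m j ^ 2 := by
      intro j; ring
    simp_rw [this]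
    rw [← Finset.mul_sum, hM2]
    field_simp
  rw [e1, e2] at key
  have hsin : 2 / Real.pi * (t * M) ≤ |Real.sin (t * M)| :=
    (Real.mul_le_sin (by positivity) (by linarith [Real.pi_gt_three])).trans (le_abs_self _)
  have hpi : (1 / 2 : ℝ) + 1 / 8 ≤ 2 / Real.pi := by
    rw [le_div_iff₀ Real.pi_pos]; linarith [Real.pi_lt_d2]
  have hexp : (3 / 5 : ℝ) ≤ Real.exp (-(t ^ 2 / 2)) := by
    have h1 : Real.exp (-(1 / 2)) ≤ Real.exp (-(t ^ 2 / 2)) := by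
      apply Real.exp_le_exp.2; nlinarith
    refine le_trans ?_ h1
    have h2 : Real.exp (-(1 / 2)) ^ 2 = Real.exp (-1) := by
      rw [← Real.exp_nat_mul]; norm_num
    have h3 := Real.exp_neg_one_gt_d9
    nlinarith [Real.exp_pos (-(1 / 2) : ℝ)]
  have hfin : (1 / 3) * (t * M) ≤ ε := by
    refine le_trans ?_ (key.trans h)
    have hs : (5 / 8) * (t * M) ≤ |Real.sin (t * M)| := by
      refine le_trans ?_ hsin
      have : 0 ≤ t * M := by positivity
      nlinarith
    calc (1 / 3) * (t * M) ≤ (3 / 5) * ((5 / 8) * (t * M)) := by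
          have : 0 ≤ t * M := by positivity
          linarith
      _ ≤ _ := by gcongr
  rcases min_choice 1 M⁻¹ with hc | hc
  · rw [← ht] at hc; rw [hc] at hfin; linarith
  · rw [← ht] at hc
    rw [hc, inv_mul_cancel₀ hpos.ne'] at hfin
    linarith

theorem sq_div_le_arctan_sub_mul {x y : ℝ} (hx : |x| ≤ 4) (hy : |y| ≤ 4) (hxy : x ≤ y) :
    (y - x) / 17 ≤ Real.arctan y - Real.arctan x ∧ Real.arctan y - Real.arctan x ≤ y - x := by
  rcases hxy.eq_or_lt with rfl | hlt
  · simp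
  obtain ⟨c, hc, hc'⟩ := exists_deriv_eq_slope Real.arctan hlt
    Real.continuous_arctan.continuousOn Real.differentiable_arctan.differentiableOn
  rw [Real.deriv_arctan, eq_div_iff (by linarith)] at hc'
  beta_reduce at hc'
  rw [← hc']
  rw [abs_le] at hx hy
  have hc2 : c ^ 2 ≤ 16 := by nlinarith [hc.1, hc.2]
  have h0 : 0 < y - x := by linarith
  constructor
  · rw [div_eq_inv_mul, ← one_div]
    gcongr
    linarith
  · refine mul_le_of_le_one_left h0.le ?_
    rw [div_le_one (by positivity)]
    nlinarith

theorem cov_le_of_integral_abs_sub_le (m : ι → ℝ) (v : ι → ℝ≥0) (hv : ∀ j, v j ≠ 0) (ε : ℝ)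
    (hε : ε ≤ 1 / 300)
    (h : ∫ x : ι → ℝ, |∏ j, gaussianPDFReal 0 1 (x j) -
        ∏ j, gaussianPDFReal (m j) (v j) (x j)| ≤ ε) :
    √(∑ j, ((v j : ℝ) - 1) ^ 2) ≤ 86 * ε := by
  have hmean := mean_le_of_integral_abs_sub_le m v hv ε hε h
  have hm2 : ∑ j, m j ^ 2 ≤ 9 * ε ^ 2 := by
    have h3 := (Real.sqrt_le_iff.1 hmean).2
    linarith
  have hm0 : 0 ≤ ∑ j, m j ^ 2 := by positivity
  set N := ∑ j, m j ^ 2 with hN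
  set s := √(∑ j, ((v j : ℝ) - 1) ^ 2) with hs
  have hs2 : ∑ j, ((v j : ℝ) - 1) ^ 2 = s ^ 2 := (Real.sq_sqrt (by positivity)).symm
  have hs0 : 0 ≤ s := Real.sqrt_nonneg _
  have hε0 : 0 ≤ ε := le_trans (by positivity) h
  rcases hs0.eq_or_lt with h0 | hpos
  · rw [← h0]; positivity
  have hle : ∀ j, |(v j : ℝ) - 1| ≤ s := by
    intro j
    refine Real.abs_le_sqrt ?_
    exact Finset.single_le_sum (f := fun j => ((v j : ℝ) - 1) ^ 2)
      (fun i _ => sq_nonneg _) (Finset.mem_univ j)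
  set t := min 1 s⁻¹ with ht
  have ht0 : 0 < t := lt_min one_pos (inv_pos.2 hpos)
  have ht1 : t ≤ 1 := min_le_left _ _
  have hts : t * s ≤ 1 := by
    calc t * s ≤ s⁻¹ * s := by gcongr; exact min_le_right _ _
      _ = 1 := inv_mul_cancel₀ hpos.ne'
  set b : ι → ℝ := fun j => t / s * ((v j : ℝ) - 1) with hb
  have hbt : ∀ j, |b j| ≤ t := by
    intro j
    rw [hb]
    simp only
    rw [abs_mul, abs_of_pos (by positivity)]
    calc t / s * |(v j : ℝ) - 1| ≤ t / s * s := by gcongr; exact hle j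
      _ = t := by field_simp
  have hbv : ∀ j, |2 * b j * v j| ≤ 4 := by
    intro j
    have h1 : (v j : ℝ) ≤ 1 + s := by linarith [(abs_le.1 (hle j)).2]
    rw [abs_mul, abs_mul, abs_two, abs_of_nonneg (NNReal.coe_nonneg _)]
    calc 2 * |b j| * v j ≤ 2 * t * (1 + s) := by gcongr; exact hbt j
      _ ≤ 4 := by linarith
  have key := exp_sum_mul_abs_sin_le (fun _ => 0) m (fun _ => 1) v
    (fun j x => b j * x ^ 2) (fun j => by fun_prop) _ _ _ _
    (fun j => integral_gaussianPDFReal_mul_cexp_quadratic 0 1 one_ne_zero (b j))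
    (fun j => integral_gaussianPDFReal_mul_cexp_quadratic (m j) (v j) (hv j) (b j))
  set A := ∑ j, (-(Real.log (1 + (2 * b j * ((1 : ℝ≥0) : ℝ)) ^ 2) / 4) -
    2 * b j ^ 2 * ((1 : ℝ≥0) : ℝ) * 0 ^ 2 / (1 + (2 * b j * ((1 : ℝ≥0) : ℝ)) ^ 2)) with hA
  set Θ := ∑ j, (Real.arctan (2 * b j * v j) / 2 + b j * m j ^ 2 / (1 + (2 * b j * v j) ^ 2) -
    (Real.arctan (2 * b j * ((1 : ℝ≥0) : ℝ)) / 2 +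
      b j * 0 ^ 2 / (1 + (2 * b j * ((1 : ℝ≥0) : ℝ)) ^ 2))) with hΘ
  have hbsq : ∑ j, b j ^ 2 = t ^ 2 := by
    simp_rw [hb, mul_pow]
    rw [← Finset.mul_sum, hs2]
    field_simp
  have hA1 : -1 ≤ A := by
    have : -∑ j, b j ^ 2 ≤ A := by
      rw [hA, ← Finset.sum_neg_distrib]
      refine Finset.sum_le_sum fun j _ => ?_
      have := Real.log_le_sub_one_of_pos (x := 1 + (2 * b j) ^ 2) (by positivity)
      simp only [NNReal.coe_one, mul_one]
      norm_num
      nlinarith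
    rw [hbsq] at this
    nlinarith
  have hpart : ∀ j, t / s * ((v j : ℝ) - 1) ^ 2 / 17 - t * m j ^ 2 ≤
      Real.arctan (2 * b j * v j) / 2 + b j * m j ^ 2 / (1 + (2 * b j * v j) ^ 2) -
      (Real.arctan (2 * b j * ((1 : ℝ≥0) : ℝ)) / 2 +
        b j * 0 ^ 2 / (1 + (2 * b j * ((1 : ℝ≥0) : ℝ)) ^ 2)) ∧
      Real.arctan (2 * b j * v j) / 2 + b j * m j ^ 2 / (1 + (2 * b j * v j) ^ 2) -
      (Real.arctan (2 * b j * ((1 : ℝ≥0) : ℝ)) / 2 +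
        b j * 0 ^ 2 / (1 + (2 * b j * ((1 : ℝ≥0) : ℝ)) ^ 2)) ≤
      t / s * ((v j : ℝ) - 1) ^ 2 + t * m j ^ 2 := by
    intro j
    have hdiff : 2 * b j * v j - 2 * b j = 2 * (t / s * ((v j : ℝ) - 1) ^ 2) := by
      rw [hb]; ring
    have hnn : 0 ≤ t / s * ((v j : ℝ) - 1) ^ 2 := by positivity
    have h1 := sq_div_le_arctan_sub_mul (x := 2 * b j) (y := 2 * b j * v j)
      (by rw [abs_mul, abs_two]; linarith [hbt j]) (hbv j) (by linarith)
    rw [hdiff] at h1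
    have h2 : |b j * m j ^ 2 / (1 + (2 * b j * v j) ^ 2)| ≤ t * m j ^ 2 := by
      rw [abs_div, abs_mul, abs_of_nonneg (sq_nonneg (m j)),
        abs_of_pos (show (0 : ℝ) < 1 + (2 * b j * v j) ^ 2 by positivity)]
      calc |b j| * m j ^ 2 / (1 + (2 * b j * v j) ^ 2) ≤ |b j| * m j ^ 2 :=
            div_le_self (by positivity) (by nlinarith [sq_nonneg (2 * b j * v j)])
        _ ≤ t * m j ^ 2 := by gcongr; exact hbt j
    rw [abs_le] at h2
    simp only [NNReal.coe_one, mul_one, ne_eq, OfNat.ofNat_ne_zero, not_false_eq_true, zero_pow,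
      mul_zero, zero_div, add_zero]
    constructor <;> linarith [h1.1, h1.2, h2.1, h2.2]
  have hΘlow : t * s / 17 - t * N ≤ Θ := by
    have := Finset.sum_le_sum fun j (_ : j ∈ Finset.univ) => (hpart j).1
    rw [Finset.sum_sub_distrib, ← Finset.sum_div, ← Finset.mul_sum, ← Finset.mul_sum, hs2] at this
    have e : t / s * s ^ 2 = t * s := by field_simp
    rwa [e] at this
  have hΘup : Θ ≤ t * s + t * N := by
    have := Finset.sum_le_sum fun j (_ : j ∈ Finset.univ) => (hpart j).2
    rw [Finset.sum_add_distrib, ← Finset.mul_sum, ← Finset.mul_sum, hs2] at this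
    have e : t / s * s ^ 2 = t * s := by field_simp
    rwa [e] at this
  have hNs : N ≤ 9 / 300 * ε := by nlinarith
  have hmain : t * s / 17 - t * N ≤ 5 * ε := by
    by_cases hneg : Θ < 0
    · linarith
    push Not at hneg
    have htN : t * N ≤ N := mul_le_of_le_one_left hm0 ht1
    have hsin : 2 / Real.pi * Θ ≤ |Real.sin Θ| :=
      (Real.mul_le_sin hneg (by linarith [Real.pi_gt_three])).trans (le_abs_self _)
    have hpi : (5 / 8 : ℝ) ≤ 2 / Real.pi := by
      rw [le_div_iff₀ Real.pi_pos]; linarith [Real.pi_lt_d2]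
    have hexp : (9 / 25 : ℝ) ≤ Real.exp A := by
      refine le_trans ?_ (Real.exp_le_exp.2 hA1)
      linarith [Real.exp_neg_one_gt_d9]
    have : (9 / 25) * (5 / 8 * Θ) ≤ Real.exp A * |Real.sin Θ| := by
      gcongr
      exact le_trans (by gcongr) hsin
    linarith [key.trans h]
  rcases min_choice 1 s⁻¹ with hc | hc
  · rw [← ht] at hc; rw [hc] at hmain; linarith
  · rw [← ht] at hc
    have htN : t * N ≤ N := mul_le_of_le_one_left hm0 ht1
    rw [hc, inv_mul_cancel₀ hpos.ne'] at hmain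
    rw [hc] at htN
    linarith

end Product

section ChiSquare

variable {ι : Type*} [Fintype ι]

open ProbabilityTheory

theorem gaussianPDFReal_sq_eq (m x : ℝ) (v : ℝ≥0) (hv : v ≠ 0) (hv2 : v < 2) :
    gaussianPDFReal m v x ^ 2 =
      ((√((v : ℝ) * (2 - v)))⁻¹ * Real.exp (m ^ 2 / (2 - v))) *
        gaussianPDFReal (2 * m / (2 - v)) (v / (2 - v)) x * gaussianPDFReal 0 1 x := by
  have hv0 : (0 : ℝ) < v := by positivity
  have hv2' : (v : ℝ) < 2 := by exact_mod_cast hv2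
  have hw : (0 : ℝ) < 2 - v := by linarith
  have hpi := Real.pi_pos
  simp only [gaussianPDFReal]
  rw [NNReal.coe_div, NNReal.coe_sub hv2.le]
  push_cast
  have hsq : (√(2 * Real.pi * v))⁻¹ ^ 2 =
      (√((v : ℝ) * (2 - v)))⁻¹ * (√(2 * Real.pi * (v / (2 - v))))⁻¹ * (√(2 * Real.pi * 1))⁻¹ := by
    rw [inv_pow, Real.sq_sqrt (by positivity), ← mul_inv, ← mul_inv,
      ← Real.sqrt_mul (by positivity), ← Real.sqrt_mul (by positivity)]
    have : (v : ℝ) * (2 - v) * (2 * Real.pi * (v / (2 - v))) * (2 * Real.pi * 1) =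
        (2 * Real.pi * v) ^ 2 := by field_simp
    rw [this, Real.sqrt_sq (by positivity)]
  have hexp : Real.exp (-(x - m) ^ 2 / (2 * v)) ^ 2 =
      Real.exp (m ^ 2 / (2 - v)) *
        Real.exp (-(x - 2 * m / (2 - v)) ^ 2 / (2 * (v / (2 - v)))) *
        Real.exp (-(x - 0) ^ 2 / (2 * 1)) := by
    rw [← Real.exp_nat_mul, ← Real.exp_add, ← Real.exp_add]
    congr 1
    have := hw.ne'
    field_simp
    push_cast
    ring
  rw [mul_pow, hsq, hexp]
  ring

theorem inv_sqrt_mul_exp_le (m v : ℝ) (hv : |v - 1| ≤ 1 / 2) :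
    (√(v * (2 - v)))⁻¹ * Real.exp (m ^ 2 / (2 - v)) ≤
      Real.exp (2 * (m ^ 2 + (v - 1) ^ 2)) := by
  have hv' := abs_le.1 hv
  have h1 : 0 < v * (2 - v) := by nlinarith [hv'.1, hv'.2]
  have h2 : (√(v * (2 - v)))⁻¹ ≤ Real.exp (2 * (v - 1) ^ 2) := by
    rw [inv_le_comm₀ (Real.sqrt_pos.2 h1) (Real.exp_pos _), ← Real.exp_neg]
    apply Real.le_sqrt_of_sq_le
    rw [← Real.exp_nat_mul]
    have hx : (v - 1) ^ 2 ≤ 1 / 4 := by nlinarith [hv'.1, hv'.2]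
    have h3 := Real.add_one_le_exp (4 * (v - 1) ^ 2)
    have h4 : Real.exp ((2 : ℕ) * -(2 * (v - 1) ^ 2)) * Real.exp (4 * (v - 1) ^ 2) = 1 := by
      rw [← Real.exp_add]; push_cast; ring_nf; exact Real.exp_zero
    have h5 := Real.exp_pos ((2 : ℕ) * -(2 * (v - 1) ^ 2))
    have h6 : v * (2 - v) = 1 - (v - 1) ^ 2 := by ring
    rw [h6]
    set y := (v - 1) ^ 2
    have hy : 0 ≤ y := sq_nonneg _
    nlinarith [mul_nonneg hy h5.le]
  have h3 : m ^ 2 / (2 - v) ≤ 2 * m ^ 2 := by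
    rw [div_le_iff₀ (by linarith [hv'.2])]
    nlinarith [sq_nonneg m, hv'.1, hv'.2]
  calc _ ≤ Real.exp (2 * (v - 1) ^ 2) * Real.exp (2 * m ^ 2) := by gcongr
    _ = _ := by rw [← Real.exp_add]; ring_nf

theorem integral_abs_sub_prod_gaussianPDFReal_le (m : ι → ℝ) (v : ι → ℝ≥0) (hv : ∀ j, v j ≠ 0)
    (R : ℝ) (hR0 : 0 < R) (hR : R ≤ 1 / 2)
    (h : ∑ j, m j ^ 2 + ∑ j, ((v j : ℝ) - 1) ^ 2 ≤ R ^ 2) :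
    ∫ x : ι → ℝ, |∏ j, gaussianPDFReal 0 1 (x j) -
        ∏ j, gaussianPDFReal (m j) (v j) (x j)| ≤ 2 * R := by
  have hm0 : 0 ≤ ∑ j, m j ^ 2 := by positivity
  have hvj : ∀ j, |(v j : ℝ) - 1| ≤ 1 / 2 := by
    intro j
    refine le_trans (Real.abs_le_sqrt (y := R ^ 2) ?_) (by rwa [Real.sqrt_sq hR0.le])
    have := Finset.single_le_sum (f := fun j => ((v j : ℝ) - 1) ^ 2)
      (fun i _ => sq_nonneg _) (Finset.mem_univ j)
    linarith
  have hv2 : ∀ j, v j < 2 := by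
    intro j
    have := (abs_le.1 (hvj j)).2
    have : (v j : ℝ) < 2 := by linarith
    exact_mod_cast this
  set K : ℝ := ∏ j, ((√((v j : ℝ) * (2 - v j)))⁻¹ * Real.exp (m j ^ 2 / (2 - v j))) with hK
  have hK1 : K - 1 ≤ (2 * R) ^ 2 := by
    have h1 : K ≤ Real.exp (2 * R ^ 2) := by
      calc K ≤ ∏ j, Real.exp (2 * (m j ^ 2 + ((v j : ℝ) - 1) ^ 2)) := by
            refine Finset.prod_le_prod (fun j _ => by positivity) fun j _ => ?_
            exact inv_sqrt_mul_exp_le (m j) (v j) (hvj j)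
        _ = Real.exp (2 * (∑ j, m j ^ 2 + ∑ j, ((v j : ℝ) - 1) ^ 2)) := by
            rw [← Real.exp_sum, ← Finset.mul_sum, Finset.sum_add_distrib]
        _ ≤ _ := by gcongr
    have hR2 : R ^ 2 ≤ 1 / 4 := by nlinarith
    have h3 := Real.add_one_le_exp (-(2 * R ^ 2))
    have h4 : Real.exp (2 * R ^ 2) * Real.exp (-(2 * R ^ 2)) = 1 := by
      rw [← Real.exp_add, add_neg_cancel, Real.exp_zero]
    have h5 := Real.exp_pos (2 * R ^ 2)
    nlinarith [sq_nonneg R]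
  set P : (ι → ℝ) → ℝ := fun x => ∏ j, gaussianPDFReal (m j) (v j) (x j) with hP
  set Q : (ι → ℝ) → ℝ := fun x => ∏ j, gaussianPDFReal 0 1 (x j) with hQ
  set G : (ι → ℝ) → ℝ := fun x => ∏ j, gaussianPDFReal (2 * m j / (2 - v j)) (v j / (2 - v j)) (x j)
    with hG
  have hPQ : ∀ x, P x ^ 2 = K * G x * Q x := by
    intro x
    simp only [hP, hQ, hG, hK]
    rw [← Finset.prod_pow, ← Finset.prod_mul_distrib, ← Finset.prod_mul_distrib]
    exact Finset.prod_congr rfl fun j _ => gaussianPDFReal_sq_eq (m j) (x j) (v j) (hv j) (hv2 j)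
  have hQpos : ∀ x, 0 < Q x := fun x =>
    Finset.prod_pos fun j _ => gaussianPDFReal_pos 0 1 (x j) one_ne_zero
  have iP : Integrable P := integrable_prod_gaussianPDFReal m v
  have iQ : Integrable Q := integrable_prod_gaussianPDFReal (fun _ => 0) (fun _ => 1)
  have iG : Integrable G := integrable_prod_gaussianPDFReal _ _
  have eP : ∫ x, P x = 1 := integral_prod_gaussianPDFReal m v hv
  have eQ : ∫ x, Q x = 1 :=
    integral_prod_gaussianPDFReal (fun _ => 0) (fun _ => 1) fun _ => one_ne_zero
  have eG : ∫ x, G x = 1 := by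
    refine integral_prod_gaussianPDFReal _ (fun j => v j / (2 - v j)) fun j => ?_
    exact div_ne_zero (hv j) (tsub_pos_of_lt (hv2 j)).ne'
  have hbound : ∀ x, |Q x - P x| ≤ R * Q x + (4 * R)⁻¹ * (K * G x - 2 * P x + Q x) := by
    intro x
    have hq := hQpos x
    have h1 : |Q x - P x| ^ 2 = Q x * (K * G x - 2 * P x + Q x) := by
      rw [sq_abs]; linear_combination hPQ x
    have h2 : K * G x - 2 * P x + Q x = |Q x - P x| ^ 2 / Q x := by
      rw [h1]; field_simp
    rw [h2]
    have h3 : R * Q x + (4 * R)⁻¹ * (|Q x - P x| ^ 2 / Q x) - |Q x - P x| =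
        (2 * R * Q x - |Q x - P x|) ^ 2 / (4 * R * Q x) := by
      field_simp; ring
    have h4 : 0 ≤ (2 * R * Q x - |Q x - P x|) ^ 2 / (4 * R * Q x) := by positivity
    linarith
  have iGP : Integrable (fun x => K * G x - 2 * P x) := (iG.const_mul K).sub (iP.const_mul 2)
  have iW : Integrable (fun x => K * G x - 2 * P x + Q x) := iGP.add iQ
  calc ∫ x, |Q x - P x| ≤ ∫ x, (R * Q x + (4 * R)⁻¹ * (K * G x - 2 * P x + Q x)) :=
        integral_mono (iQ.sub iP).abs ((iQ.const_mul R).add (iW.const_mul _)) hbound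
    _ = R + (4 * R)⁻¹ * (K - 1) := by
        rw [integral_add (iQ.const_mul R) (iW.const_mul _), integral_const_mul, integral_const_mul,
          integral_add iGP iQ,
          integral_sub (iG.const_mul K) (iP.const_mul 2), integral_const_mul, integral_const_mul,
          eP, eQ, eG]
        ring
    _ ≤ R + (4 * R)⁻¹ * (2 * R) ^ 2 := by gcongr
    _ = 2 * R := by field_simp; ring

end ChiSquare

section Density

variable {d : ℕ}

/-- The Lebesgue density of `gaussianMeasure`. -/
noncomputable def gaussianDensity (d : ℕ) (μ : Fin d → ℝ) (S : Matrix (Fin d) (Fin d) ℝ)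
    (x : Fin d → ℝ) : ℝ :=
  (Real.sqrt ((2 * Real.pi) ^ d * S.det))⁻¹ *
    Real.exp (-(1 / 2) * ((fun i => x i - μ i) ⬝ᵥ S⁻¹.mulVec (fun i => x i - μ i)))

open ProbabilityTheory in
theorem gaussianDensity_diagonal (m : Fin d → ℝ) (v : Fin d → ℝ≥0) (hv : ∀ j, v j ≠ 0)
    (x : Fin d → ℝ) :
    gaussianDensity d m (diagonal fun j => (v j : ℝ)) x =
      ∏ j, gaussianPDFReal (m j) (v j) (x j) := by
  have hv' : ∀ j, (v j : ℝ) ≠ 0 := fun j => by exact_mod_cast hv j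
  have hinv : (diagonal fun j => (v j : ℝ))⁻¹ = diagonal fun j => (v j : ℝ)⁻¹ := by
    refine Matrix.inv_eq_right_inv ?_
    rw [Matrix.diagonal_mul_diagonal]
    simp [hv']
  simp only [gaussianDensity, gaussianPDFReal]
  rw [Finset.prod_mul_distrib, ← Real.exp_sum, hinv, Matrix.det_diagonal]
  congr 1
  · rw [Finset.prod_inv_distrib, ← Real.sqrt_prod _ (fun j _ => by positivity),
      Finset.prod_mul_distrib]
    simp
  · congr 1
    simp only [dotProduct, Matrix.mulVec_diagonal]
    rw [Finset.mul_sum]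
    refine Finset.sum_congr rfl fun j _ => ?_
    have := hv' j
    field_simp

theorem gaussianDensity_affine (T S : Matrix (Fin d) (Fin d) ℝ) (hT : T.det ≠ 0)
    (c μ x : Fin d → ℝ) :
    |T.det| * gaussianDensity d (T *ᵥ (μ - c)) (T * S * Tᵀ) (T *ᵥ (x - c)) =
      gaussianDensity d μ S x := by
  have hT0 : 0 < |T.det| := abs_pos.2 hT
  have hU : IsUnit T.det := isUnit_iff_ne_zero.2 hT
  have hdet : √((2 * Real.pi) ^ d * (T * S * Tᵀ).det) =
      |T.det| * √((2 * Real.pi) ^ d * S.det) := by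
    rw [Matrix.det_mul, Matrix.det_mul, Matrix.det_transpose, ← Real.sqrt_sq_eq_abs,
      ← Real.sqrt_mul (sq_nonneg _)]
    congr 1; ring
  have hvec : (fun i => (T *ᵥ (x - c)) i - (T *ᵥ (μ - c)) i) = T *ᵥ (x - μ) := by
    have : (fun i => (T *ᵥ (x - c)) i - (T *ᵥ (μ - c)) i) = T *ᵥ (x - c) - T *ᵥ (μ - c) := rfl
    rw [this, ← Matrix.mulVec_sub]
    congr 1; abel
  have hquad : (T *ᵥ (x - μ)) ⬝ᵥ ((T * S * Tᵀ)⁻¹ *ᵥ (T *ᵥ (x - μ))) =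
      (x - μ) ⬝ᵥ (S⁻¹ *ᵥ (x - μ)) := by
    rw [Matrix.mul_inv_rev, Matrix.mul_inv_rev, Matrix.mulVec_mulVec, Matrix.mul_assoc,
      Matrix.mul_assoc, Matrix.nonsing_inv_mul _ hU, Matrix.mul_one, ← Matrix.mulVec_mulVec,
      ← Matrix.transpose_nonsing_inv, Matrix.dotProduct_mulVec, Matrix.vecMul_transpose,
      Matrix.mulVec_mulVec, Matrix.nonsing_inv_mul _ hU, Matrix.one_mulVec]
  simp only [gaussianDensity]
  rw [hvec, hdet, hquad, mul_inv, ← mul_assoc, ← mul_assoc, mul_inv_cancel₀ hT0.ne', one_mul]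
  rfl

theorem integral_abs_det_mul_comp_affine (T : Matrix (Fin d) (Fin d) ℝ) (hT : T.det ≠ 0)
    (c : Fin d → ℝ) (F : (Fin d → ℝ) → ℝ) :
    ∫ x, |T.det| * F (T *ᵥ (x - c)) = ∫ x, F x := by
  rw [integral_sub_right_eq_self (fun x => |T.det| * F (T *ᵥ x)) c]
  have hmap := Real.map_matrix_volume_pi_eq_smul_volume_pi hT
  have hemb : MeasurableEmbedding (Matrix.toLin' T) := by
    have : Function.Bijective (Matrix.toLin' T) := by
      have hU : IsUnit T := (Matrix.isUnit_iff_isUnit_det T).2 (isUnit_iff_ne_zero.2 hT)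
      exact ⟨Matrix.mulVec_injective_iff_isUnit.2 hU, Matrix.mulVec_surjective_iff_isUnit.2 hU⟩
    exact (LinearEquiv.ofBijective _ this).toContinuousLinearEquiv.toHomeomorph.measurableEmbedding
  have h := hemb.integral_map (μ := volume) F
  rw [hmap, integral_smul_measure] at h
  rw [integral_const_mul]
  simp only [Matrix.toLin'_apply] at h
  rw [← h, ENNReal.toReal_ofReal (abs_nonneg _), abs_inv, smul_eq_mul, ← mul_assoc,
    mul_inv_cancel₀ (abs_pos.2 hT).ne', one_mul]

theorem integrable_abs_det_mul_comp_affine (T : Matrix (Fin d) (Fin d) ℝ) (hT : T.det ≠ 0)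
    (c : Fin d → ℝ) (F : (Fin d → ℝ) → ℝ) (hF : Integrable F) :
    Integrable fun x => |T.det| * F (T *ᵥ (x - c)) := by
  have hmap := Real.map_matrix_volume_pi_eq_smul_volume_pi hT
  have h1 : Integrable F (Measure.map (Matrix.toLin' T) volume) := by
    rw [hmap]; exact hF.smul_measure ENNReal.ofReal_ne_top
  have h2 := h1.comp_measurable (Matrix.toLin' T).continuous_of_finiteDimensional.measurable
  exact (h2.comp_sub_right c).const_mul _

/-- The `L¹` distance between two Gaussian densities is invariant under affine maps. -/
theorem integral_abs_sub_gaussianDensity_affine (T : Matrix (Fin d) (Fin d) ℝ) (hT : T.det ≠ 0)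
    (c μ μ' : Fin d → ℝ) (S S' : Matrix (Fin d) (Fin d) ℝ) :
    ∫ x, |gaussianDensity d (T *ᵥ (μ - c)) (T * S * Tᵀ) x -
        gaussianDensity d (T *ᵥ (μ' - c)) (T * S' * Tᵀ) x| =
      ∫ x, |gaussianDensity d μ S x - gaussianDensity d μ' S' x| := by
  rw [← integral_abs_det_mul_comp_affine T hT c]
  congr 1; ext x
  rw [← gaussianDensity_affine T S hT c, ← gaussianDensity_affine T S' hT c, ← mul_sub, abs_mul,
    abs_abs]

theorem Matrix.PosDef.exists_orthogonal_diagonal {S : Matrix (Fin d) (Fin d) ℝ} (hS : S.PosDef) :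
    ∃ (U : Matrix (Fin d) (Fin d) ℝ) (v : Fin d → ℝ≥0), U * Uᵀ = 1 ∧ Uᵀ * U = 1 ∧
      (∀ j, v j ≠ 0) ∧ U * S * Uᵀ = diagonal fun j => (v j : ℝ) := by
  set V : Matrix (Fin d) (Fin d) ℝ := hS.isHermitian.eigenvectorUnitary.1 with hV
  have hV1 : Vᵀ * V = 1 := by
    have := Unitary.coe_star_mul_self hS.isHermitian.eigenvectorUnitary
    rwa [Matrix.star_eq_conjTranspose, Matrix.conjTranspose_eq_transpose_of_trivial] at this
  have hV2 : V * Vᵀ = 1 := mul_eq_one_comm.1 hV1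
  have hspec := hS.isHermitian.spectral_theorem
  rw [Unitary.conjStarAlgAut_apply, Matrix.star_eq_conjTranspose,
    Matrix.conjTranspose_eq_transpose_of_trivial, ← hV] at hspec
  refine ⟨Vᵀ, fun j => ⟨hS.isHermitian.eigenvalues j, (hS.eigenvalues_pos j).le⟩, ?_, ?_, ?_, ?_⟩
  · rwa [Matrix.transpose_transpose]
  · rwa [Matrix.transpose_transpose]
  · intro j h
    have := congrArg NNReal.toReal h
    exact (hS.eigenvalues_pos j).ne' this
  · rw [Matrix.transpose_transpose]
    conv_lhs => rw [hspec]
    rw [← Matrix.mul_assoc, ← Matrix.mul_assoc, hV1, Matrix.one_mul, Matrix.mul_assoc, hV1,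
      Matrix.mul_one]
    rfl

theorem Matrix.PosDef.exists_whitening {S : Matrix (Fin d) (Fin d) ℝ} (hS : S.PosDef) :
    ∃ B : Matrix (Fin d) (Fin d) ℝ, B.det ≠ 0 ∧ B * S * Bᵀ = 1 := by
  obtain ⟨U, v, -, -, hv, hUS⟩ := hS.exists_orthogonal_diagonal
  have h1 : (diagonal fun j => (√(v j : ℝ))⁻¹) * U * S * ((diagonal fun j => (√(v j : ℝ))⁻¹) * U)ᵀ
      = 1 := by
    rw [Matrix.transpose_mul, Matrix.diagonal_transpose, ← Matrix.mul_assoc,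
      Matrix.mul_assoc _ U S, Matrix.mul_assoc _ (U * S), hUS, Matrix.diagonal_mul_diagonal,
      Matrix.diagonal_mul_diagonal, ← Matrix.diagonal_one]
    congr 1; ext j
    have hj : (0 : ℝ) < v j := by have := hv j; positivity
    rw [mul_right_comm, ← mul_inv, Real.mul_self_sqrt hj.le, inv_mul_cancel₀ hj.ne']
  refine ⟨_, ?_, h1⟩
  intro h0
  have := congrArg Matrix.det h1
  rw [Matrix.det_mul, Matrix.det_mul, h0] at this
  simp at this

theorem integrable_gaussianDensity (μ : Fin d → ℝ) {S : Matrix (Fin d) (Fin d) ℝ}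
    (hS : S.PosDef) : Integrable (gaussianDensity d μ S) := by
  obtain ⟨U, v, hU, -, hv, hUS⟩ := hS.exists_orthogonal_diagonal
  have hdet : U.det ≠ 0 := by
    intro h0
    have := congrArg Matrix.det hU
    rw [Matrix.det_mul, h0] at this
    simp at this
  have h1 : Integrable (gaussianDensity d (U *ᵥ (μ - 0)) (U * S * Uᵀ)) := by
    rw [hUS]
    refine (integrable_prod_gaussianPDFReal (U *ᵥ (μ - 0)) v).congr ?_
    exact Filter.Eventually.of_forall fun x => (gaussianDensity_diagonal _ v hv x).symm
  refine (integrable_abs_det_mul_comp_affine U hdet 0 _ h1).congr ?_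
  exact Filter.Eventually.of_forall fun x => gaussianDensity_affine U S hdet 0 μ x

theorem gaussianDensity_nonneg (μ : Fin d → ℝ) (S : Matrix (Fin d) (Fin d) ℝ) (x : Fin d → ℝ) :
    0 ≤ gaussianDensity d μ S x := by
  unfold gaussianDensity; positivity

end Density

section Standard

variable {d : ℕ}

theorem dotProduct_mulVec_self_of_transpose_mul (U : Matrix (Fin d) (Fin d) ℝ) (hU : Uᵀ * U = 1)
    (m : Fin d → ℝ) : ∑ i, (U *ᵥ m) i ^ 2 = ∑ i, m i ^ 2 := by
  have h : (U *ᵥ m) ⬝ᵥ (U *ᵥ m) = m ⬝ᵥ m := by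
    rw [Matrix.dotProduct_mulVec, Matrix.vecMul_mulVec, hU, Matrix.vecMul_one]
  simpa only [dotProduct, ← pow_two] using h

theorem sum_sum_sq_eq_trace (X : Matrix (Fin d) (Fin d) ℝ) :
    ∑ i, ∑ j, X i j ^ 2 = (X * Xᵀ).trace := by
  simp only [Matrix.trace, Matrix.diag, Matrix.mul_apply, Matrix.transpose_apply, pow_two]

theorem sum_sum_sq_orthogonal_conj (U : Matrix (Fin d) (Fin d) ℝ) (hU : Uᵀ * U = 1)
    (X : Matrix (Fin d) (Fin d) ℝ) :
    ∑ i, ∑ j, (U * X * Uᵀ) i j ^ 2 = ∑ i, ∑ j, X i j ^ 2 := by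
  rw [sum_sum_sq_eq_trace, sum_sum_sq_eq_trace]
  have : U * X * Uᵀ * (U * X * Uᵀ)ᵀ = U * (X * Xᵀ * Uᵀ) := by
    simp only [Matrix.transpose_mul, Matrix.transpose_transpose]
    calc U * X * Uᵀ * (U * (Xᵀ * Uᵀ)) = U * X * (Uᵀ * U) * (Xᵀ * Uᵀ) := by
          simp only [Matrix.mul_assoc]
      _ = _ := by rw [hU]; simp only [Matrix.mul_assoc, Matrix.one_mul]
  rw [this, Matrix.trace_mul_comm, Matrix.mul_assoc, hU, Matrix.mul_one]

theorem sum_sum_sq_diagonal_sub_one (v : Fin d → ℝ) :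
    ∑ i, ∑ j, (diagonal v - 1 : Matrix (Fin d) (Fin d) ℝ) i j ^ 2 = ∑ i, (v i - 1) ^ 2 := by
  refine Finset.sum_congr rfl fun i _ => ?_
  rw [Finset.sum_eq_single i]
  · simp
  · intro j _ hj
    simp [Matrix.diagonal_apply_ne' _ hj, Matrix.one_apply_ne' hj]
  · simp

open ProbabilityTheory in
/-- Rotating a Gaussian to principal axes, relative to the standard one. -/
theorem exists_principal_axes (m : Fin d → ℝ) {S : Matrix (Fin d) (Fin d) ℝ} (hS : S.PosDef) :
    ∃ (m' : Fin d → ℝ) (v : Fin d → ℝ≥0), (∀ j, v j ≠ 0) ∧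
      ∑ i, m' i ^ 2 = ∑ i, m i ^ 2 ∧
      ∑ i, ((v i : ℝ) - 1) ^ 2 = ∑ i, ∑ j, (S - 1) i j ^ 2 ∧
      ∫ x, |gaussianDensity d 0 1 x - gaussianDensity d m S x| =
        ∫ x : Fin d → ℝ, |∏ j, gaussianPDFReal 0 1 (x j) -
          ∏ j, gaussianPDFReal (m' j) (v j) (x j)| := by
  obtain ⟨U, v, hU, hU', hv, hUS⟩ := hS.exists_orthogonal_diagonal
  have hdet : U.det ≠ 0 := by
    intro h0
    have := congrArg Matrix.det hU
    rw [Matrix.det_mul, h0] at this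
    simp at this
  refine ⟨U *ᵥ m, v, hv, dotProduct_mulVec_self_of_transpose_mul U hU' m, ?_, ?_⟩
  · rw [← sum_sum_sq_diagonal_sub_one, ← hUS, ← sum_sum_sq_orthogonal_conj U hU' (S - 1)]
    rw [Matrix.mul_sub, Matrix.sub_mul, Matrix.mul_one, hU]
  · rw [← integral_abs_sub_gaussianDensity_affine U hdet 0]
    rw [hUS, Matrix.mul_one, hU, sub_zero, sub_zero, Matrix.mulVec_zero]
    congr 1; ext x
    rw [gaussianDensity_diagonal _ v hv]
    have h1 : (1 : Matrix (Fin d) (Fin d) ℝ) = diagonal fun j => (((1 : ℝ≥0)) : ℝ) := by simp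
    rw [h1, gaussianDensity_diagonal _ (fun _ => 1) fun _ => one_ne_zero]
    rfl

theorem parameters_le_of_integral_abs_sub_le (m : Fin d → ℝ) {S : Matrix (Fin d) (Fin d) ℝ}
    (hS : S.PosDef) (ε : ℝ) (hε : ε ≤ 1 / 300)
    (h : ∫ x, |gaussianDensity d 0 1 x - gaussianDensity d m S x| ≤ ε) :
    ∑ i, m i ^ 2 ≤ (3 * ε) ^ 2 ∧ ∑ i, ∑ j, (S - 1) i j ^ 2 ≤ (86 * ε) ^ 2 := by
  obtain ⟨m', v, hv, h1, h2, h3⟩ := exists_principal_axes m hS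
  rw [h3] at h
  rw [← h1, ← h2]
  exact ⟨(Real.sqrt_le_iff.1 (mean_le_of_integral_abs_sub_le m' v hv ε hε h)).2,
    (Real.sqrt_le_iff.1 (cov_le_of_integral_abs_sub_le m' v hv ε hε h)).2⟩

theorem integral_abs_sub_standard_le (m : Fin d → ℝ) {S : Matrix (Fin d) (Fin d) ℝ}
    (hS : S.PosDef) (R : ℝ) (hR0 : 0 < R) (hR : R ≤ 1 / 2)
    (h : ∑ i, m i ^ 2 + ∑ i, ∑ j, (S - 1) i j ^ 2 ≤ R ^ 2) :
    ∫ x, |gaussianDensity d 0 1 x - gaussianDensity d m S x| ≤ 2 * R := by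
  obtain ⟨m', v, hv, h1, h2, h3⟩ := exists_principal_axes m hS
  rw [h3]
  rw [← h1, ← h2] at h
  exact integral_abs_sub_prod_gaussianPDFReal_le m' v hv R hR0 hR h

theorem sum_sq_whitening_mulVec_le (B Y : Matrix (Fin d) (Fin d) ℝ) (hB : B * Y * Bᵀ = 1)
    (hY : ∑ i, ∑ j, (Y - 1) i j ^ 2 ≤ 1 / 4) (v : Fin d → ℝ) :
    ∑ i, (B *ᵥ v) i ^ 2 ≤ 2 * ∑ i, v i ^ 2 := by
  have hYM : Y * (Bᵀ * B) = 1 := by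
    refine mul_eq_one_comm.1 ?_
    rw [Matrix.mul_assoc]
    exact mul_eq_one_comm.1 hB
  set w := (Bᵀ * B) *ᵥ v with hw
  have ha : ∑ i, (B *ᵥ v) i ^ 2 = v ⬝ᵥ w := by
    rw [hw, ← Matrix.mulVec_mulVec, Matrix.dotProduct_mulVec, Matrix.vecMul_transpose]
    simp only [dotProduct, pow_two]
  have hYw : Y *ᵥ w = v := by rw [hw, Matrix.mulVec_mulVec, hYM, Matrix.one_mulVec]
  set a := ∑ i, (B *ᵥ v) i ^ 2 with hadef
  have ha0 : 0 ≤ a := by positivity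
  set V := ∑ i, v i ^ 2 with hV
  set W := ∑ i, w i ^ 2 with hW
  have hW0 : 0 ≤ W := by positivity
  have hV0 : 0 ≤ V := by positivity
  have hquad : a = W + w ⬝ᵥ ((Y - 1) *ᵥ w) := by
    rw [Matrix.sub_mulVec, hYw, Matrix.one_mulVec, dotProduct_sub, ha, dotProduct_comm w v]
    have : w ⬝ᵥ w = W := by simp only [dotProduct, hW, pow_two]
    rw [this]; ring
  have hcs : (w ⬝ᵥ ((Y - 1) *ᵥ w)) ^ 2 ≤ (W / 2) ^ 2 := by
    have e1 : w ⬝ᵥ ((Y - 1) *ᵥ w) =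
        ∑ p : Fin d × Fin d, (w p.1 * w p.2) * (Y - 1) p.1 p.2 := by
      rw [Fintype.sum_prod_type]
      simp only [dotProduct, Matrix.mulVec, Finset.mul_sum]
      refine Finset.sum_congr rfl fun i _ => Finset.sum_congr rfl fun j _ => by ring
    have e2 : ∑ p : Fin d × Fin d, (w p.1 * w p.2) ^ 2 = W ^ 2 := by
      rw [Fintype.sum_prod_type, pow_two W, hW, Finset.sum_mul_sum]
      refine Finset.sum_congr rfl fun i _ => Finset.sum_congr rfl fun j _ => by ring
    rw [← Fintype.sum_prod_type' (f := fun i j => (Y - 1) i j ^ 2)] at hY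
    calc _ ≤ (∑ p : Fin d × Fin d, (w p.1 * w p.2) ^ 2) *
          ∑ p : Fin d × Fin d, (Y - 1) p.1 p.2 ^ 2 := by
          rw [e1]; exact Finset.sum_mul_sq_le_sq_mul_sq _ _ _
      _ ≤ W ^ 2 * (1 / 4) := by rw [e2]; gcongr
      _ = _ := by ring
  have hhalf := (abs_le.1 (abs_le_of_sq_le_sq hcs (by positivity))).1
  have hav : a ^ 2 ≤ V * W := by
    rw [ha]; exact Finset.sum_mul_sq_le_sq_mul_sq _ _ _
  have hWa : W ≤ 2 * a := by linarith
  have : a * a ≤ a * (2 * V) := by nlinarith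
  rcases ha0.eq_or_lt with h0 | hpos
  · rw [← h0]; positivity
  · exact le_of_mul_le_mul_left this hpos

theorem sum_sum_sq_mul_le (A X : Matrix (Fin d) (Fin d) ℝ) (K : ℝ)
    (hA : ∀ v : Fin d → ℝ, ∑ i, (A *ᵥ v) i ^ 2 ≤ K * ∑ i, v i ^ 2) :
    ∑ i, ∑ j, (A * X) i j ^ 2 ≤ K * ∑ i, ∑ j, X i j ^ 2 := by
  rw [Finset.sum_comm, Finset.sum_comm (f := fun i j => X i j ^ 2), Finset.mul_sum]
  refine Finset.sum_le_sum fun j _ => ?_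
  exact hA fun i => X i j

theorem sum_sum_sq_conj_le (A X : Matrix (Fin d) (Fin d) ℝ) (K : ℝ) (hK : 0 ≤ K)
    (hA : ∀ v : Fin d → ℝ, ∑ i, (A *ᵥ v) i ^ 2 ≤ K * ∑ i, v i ^ 2) :
    ∑ i, ∑ j, (A * X * Aᵀ) i j ^ 2 ≤ K ^ 2 * ∑ i, ∑ j, X i j ^ 2 := by
  have h1 : A * X * Aᵀ = (A * (A * X)ᵀ)ᵀ := by
    rw [Matrix.transpose_mul, Matrix.transpose_transpose]
  rw [h1]
  simp only [Matrix.transpose_apply]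
  rw [Finset.sum_comm]
  calc _ ≤ K * ∑ i, ∑ j, (A * X)ᵀ i j ^ 2 := sum_sum_sq_mul_le _ _ K hA
    _ = K * ∑ i, ∑ j, (A * X) i j ^ 2 := by
        simp only [Matrix.transpose_apply]; rw [Finset.sum_comm]
    _ ≤ K * (K * ∑ i, ∑ j, X i j ^ 2) := by gcongr; exact sum_sum_sq_mul_le _ _ K hA
    _ = _ := by ring

theorem posDef_conj {S : Matrix (Fin d) (Fin d) ℝ} (hS : S.PosDef) (B : Matrix (Fin d) (Fin d) ℝ)
    (hB : B.det ≠ 0) : (B * S * Bᵀ).PosDef := by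
  have hU : IsUnit B := (Matrix.isUnit_iff_isUnit_det B).2 (isUnit_iff_ne_zero.2 hB)
  have := hS.mul_mul_conjTranspose_same (B := B) (Matrix.vecMul_injective_iff_isUnit.2 hU)
  rwa [Matrix.conjTranspose_eq_transpose_of_trivial] at this

/-- Close to the standard Gaussian, the `L¹` distance of densities is at most a constant multiple
of the Euclidean distance of the parameters. -/
theorem integral_abs_sub_gaussianDensity_le (m₁ m₂ : Fin d → ℝ) {Y₁ Y₂ : Matrix (Fin d) (Fin d) ℝ}
    (hY₁ : Y₁.PosDef) (hY₂ : Y₂.PosDef) (hY : ∑ i, ∑ j, (Y₁ - 1) i j ^ 2 ≤ 1 / 4)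
    (r : ℝ) (hr0 : 0 < r) (hr : r ≤ 1 / 4)
    (h : ∑ i, (m₂ - m₁) i ^ 2 + ∑ i, ∑ j, (Y₂ - Y₁) i j ^ 2 ≤ r ^ 2) :
    ∫ x, |gaussianDensity d m₁ Y₁ x - gaussianDensity d m₂ Y₂ x| ≤ 4 * r := by
  obtain ⟨B, hdet, hB⟩ := hY₁.exists_whitening
  have hBv := sum_sq_whitening_mulVec_le B Y₁ hB hY
  rw [← integral_abs_sub_gaussianDensity_affine B hdet m₁, sub_self, Matrix.mulVec_zero, hB]
  have h1 := hBv (m₂ - m₁)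
  have h2 := sum_sum_sq_conj_le B (Y₂ - Y₁) 2 zero_le_two hBv
  rw [Matrix.mul_sub, Matrix.sub_mul, hB] at h2
  have h3 : 0 ≤ ∑ i, (m₂ - m₁) i ^ 2 := by positivity
  have := integral_abs_sub_standard_le (B *ᵥ (m₂ - m₁)) (posDef_conj hY₂ B hdet) (2 * r)
    (by positivity) (by linarith) (by linarith)
  linarith

end Standard

section TotalVariation

variable {d : ℕ}

theorem gaussianMeasure_apply_toReal (μ : Fin d → ℝ) {S : Matrix (Fin d) (Fin d) ℝ}
    (hS : S.PosDef) {A : Set (Fin d → ℝ)} (hA : MeasurableSet A) :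
    (gaussianMeasure d μ S A).toReal = ∫ x in A, gaussianDensity d μ S x := by
  rw [integral_eq_lintegral_of_nonneg_ae
    (Filter.Eventually.of_forall fun x => gaussianDensity_nonneg μ S x)
    (integrable_gaussianDensity μ hS).integrableOn.aestronglyMeasurable]
  unfold gaussianMeasure
  rw [withDensity_apply _ hA]
  rfl

variable (μ₁ μ₂ : Fin d → ℝ) {S₁ S₂ : Matrix (Fin d) (Fin d) ℝ}

theorem abs_gaussianMeasure_sub_le (hS₁ : S₁.PosDef) (hS₂ : S₂.PosDef)
    {A : Set (Fin d → ℝ)} (hA : MeasurableSet A) :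
    |(gaussianMeasure d μ₁ S₁ A).toReal - (gaussianMeasure d μ₂ S₂ A).toReal| ≤
      ∫ x, |gaussianDensity d μ₁ S₁ x - gaussianDensity d μ₂ S₂ x| := by
  have h₁ := integrable_gaussianDensity μ₁ hS₁
  have h₂ := integrable_gaussianDensity μ₂ hS₂
  rw [gaussianMeasure_apply_toReal μ₁ hS₁ hA, gaussianMeasure_apply_toReal μ₂ hS₂ hA,
    ← integral_sub h₁.integrableOn h₂.integrableOn]
  refine abs_integral_le_integral_abs.trans ?_
  exact setIntegral_le_integral (h₁.sub h₂).abs (Filter.Eventually.of_forall fun x => abs_nonneg _)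

theorem tvDist_gaussianMeasure_le (hS₁ : S₁.PosDef) (hS₂ : S₂.PosDef) :
    tvDist (gaussianMeasure d μ₁ S₁) (gaussianMeasure d μ₂ S₂) ≤
      ∫ x, |gaussianDensity d μ₁ S₁ x - gaussianDensity d μ₂ S₂ x| := by
  have : Nonempty {A : Set (Fin d → ℝ) // MeasurableSet A} := ⟨⟨∅, MeasurableSet.empty⟩⟩
  exact ciSup_le fun A => abs_gaussianMeasure_sub_le μ₁ μ₂ hS₁ hS₂ A.2

theorem integral_abs_sub_le_two_mul_tvDist (hS₁ : S₁.PosDef) (hS₂ : S₂.PosDef) :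
    ∫ x, |gaussianDensity d μ₁ S₁ x - gaussianDensity d μ₂ S₂ x| ≤
      2 * tvDist (gaussianMeasure d μ₁ S₁) (gaussianMeasure d μ₂ S₂) := by
  have h₁ := integrable_gaussianDensity μ₁ hS₁
  have h₂ := integrable_gaussianDensity μ₂ hS₂
  have hle : ∀ A : Set (Fin d → ℝ), MeasurableSet A →
      |∫ x in A, (gaussianDensity d μ₁ S₁ x - gaussianDensity d μ₂ S₂ x)| ≤
        tvDist (gaussianMeasure d μ₁ S₁) (gaussianMeasure d μ₂ S₂) := by
    intro A hA
    rw [integral_sub h₁.integrableOn h₂.integrableOn, ← gaussianMeasure_apply_toReal μ₁ hS₁ hA,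
      ← gaussianMeasure_apply_toReal μ₂ hS₂ hA]
    refine le_ciSup (f := fun A : {A : Set (Fin d → ℝ) // MeasurableSet A} =>
      |(gaussianMeasure d μ₁ S₁ A).toReal - (gaussianMeasure d μ₂ S₂ A).toReal|) ?_ ⟨A, hA⟩
    refine ⟨∫ x, |gaussianDensity d μ₁ S₁ x - gaussianDensity d μ₂ S₂ x|, ?_⟩
    rintro _ ⟨A, rfl⟩
    exact abs_gaussianMeasure_sub_le μ₁ μ₂ hS₁ hS₂ A.2
  have hcont : ∀ (μ : Fin d → ℝ) (S : Matrix (Fin d) (Fin d) ℝ),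
      Measurable (gaussianDensity d μ S) := by
    intro μ S
    refine Continuous.measurable ?_
    unfold gaussianDensity
    simp only [dotProduct, Matrix.mulVec]
    fun_prop
  set A : Set (Fin d → ℝ) := {x | gaussianDensity d μ₂ S₂ x ≤ gaussianDensity d μ₁ S₁ x} with hAdef
  have hA : MeasurableSet A := measurableSet_le (hcont _ _) (hcont _ _)
  have h₁₂ : Integrable (fun x => |gaussianDensity d μ₁ S₁ x - gaussianDensity d μ₂ S₂ x|) :=
    (h₁.sub h₂).abs
  rw [← integral_add_compl hA h₁₂]
  have e1 : ∫ x in A, |gaussianDensity d μ₁ S₁ x - gaussianDensity d μ₂ S₂ x| =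
      ∫ x in A, (gaussianDensity d μ₁ S₁ x - gaussianDensity d μ₂ S₂ x) :=
    setIntegral_congr_fun hA fun x hx => abs_of_nonneg (sub_nonneg.2 hx)
  have e2 : ∫ x in Aᶜ, |gaussianDensity d μ₁ S₁ x - gaussianDensity d μ₂ S₂ x| =
      -∫ x in Aᶜ, (gaussianDensity d μ₁ S₁ x - gaussianDensity d μ₂ S₂ x) := by
    rw [← integral_neg]
    exact setIntegral_congr_fun hA.compl fun x hx => abs_of_neg (sub_neg.2 (not_le.1 hx))
  have i1 := (le_abs_self _).trans (hle A hA)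
  have i2 := (neg_le_abs _).trans (hle Aᶜ hA.compl)
  rw [e1, e2]
  linarith

theorem tvDist_comm {Ω : Type*} [MeasurableSpace Ω] (μ ν : Measure Ω) :
    tvDist μ ν = tvDist ν μ := by
  unfold tvDist
  simp_rw [abs_sub_comm]

theorem tvDist_self {Ω : Type*} [MeasurableSpace Ω] (μ : Measure Ω) : tvDist μ μ = 0 := by
  unfold tvDist
  simp

end TotalVariation

section Packing

open Metric Module Function

theorem card_mul_pow_le_of_separated {E : Type*} [NormedAddCommGroup E] [NormedSpace ℝ E]
    [FiniteDimensional ℝ E] (s : Finset E) {r δ : ℝ} (hr : 0 ≤ r) (hδ : 0 < δ)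
    (hs : ∀ c ∈ s, ‖c‖ ≤ r) (h : ∀ c ∈ s, ∀ d ∈ s, c ≠ d → 2 * δ ≤ ‖c - d‖) :
    (s.card : ℝ) * δ ^ finrank ℝ E ≤ (r + δ) ^ finrank ℝ E := by
  borelize E
  let μ : Measure E := Measure.addHaar
  have hρ : 0 < r + δ := by positivity
  have D : Set.Pairwise (s : Set E) (Disjoint on fun c => ball (c : E) δ) := by
    rintro c hc d hd hcd
    apply ball_disjoint_ball
    rw [dist_eq_norm]
    linarith [h c hc d hd hcd]
  have hsub : ⋃ c ∈ s, ball (c : E) δ ⊆ ball (0 : E) (r + δ) := by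
    refine Set.iUnion₂_subset fun x hx => ?_
    apply ball_subset_ball'
    rw [dist_zero_right]
    linarith [hs x hx]
  have I : (s.card : ENNReal) * ENNReal.ofReal (δ ^ finrank ℝ E) * μ (ball 0 1) ≤
      ENNReal.ofReal ((r + δ) ^ finrank ℝ E) * μ (ball 0 1) :=
    calc _ = μ (⋃ c ∈ s, ball (c : E) δ) := by
          rw [measure_biUnion_finset D fun c _ => measurableSet_ball]
          simp only [μ.addHaar_ball_of_pos _ hδ, Finset.sum_const, nsmul_eq_mul, mul_assoc]
      _ ≤ μ (ball (0 : E) (r + δ)) := measure_mono hsub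
      _ = _ := by simp only [μ.addHaar_ball_of_pos _ hρ]
  have J := (ENNReal.mul_le_mul_iff_left (measure_ball_pos μ _ zero_lt_one).ne'
    measure_ball_lt_top.ne).1 I
  have := ENNReal.toReal_le_of_le_ofReal (pow_nonneg hρ.le _) J
  rwa [ENNReal.toReal_mul, ENNReal.toReal_natCast, ENNReal.toReal_ofReal (by positivity)] at this

end Packing

section Cover

/-- The parameters of a Gaussian after the affine change of variables `x ↦ B (x - c)`, relative to
the standard Gaussian. -/
noncomputable def relativeParameters {d : ℕ} (B : Matrix (Fin d) (Fin d) ℝ) (c : Fin d → ℝ)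
    (p : (Fin d → ℝ) × Matrix (Fin d) (Fin d) ℝ) :
    EuclideanSpace ℝ (Fin d ⊕ (Fin d × Fin d)) :=
  WithLp.toLp 2 (Sum.elim (B *ᵥ (p.1 - c)) fun ij => (B * p.2 * Bᵀ - 1) ij.1 ij.2)

theorem norm_relativeParameters_sq {d : ℕ} (B : Matrix (Fin d) (Fin d) ℝ) (c : Fin d → ℝ)
    (p : (Fin d → ℝ) × Matrix (Fin d) (Fin d) ℝ) :
    ‖relativeParameters B c p‖ ^ 2 =
      ∑ i, (B *ᵥ (p.1 - c)) i ^ 2 + ∑ i, ∑ j, (B * p.2 * Bᵀ - 1) i j ^ 2 := by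
  rw [EuclideanSpace.norm_sq_eq, Fintype.sum_sum_type, Fintype.sum_prod_type]
  simp [relativeParameters]

theorem norm_relativeParameters_sub_sq {d : ℕ} (B : Matrix (Fin d) (Fin d) ℝ) (c : Fin d → ℝ)
    (p q : (Fin d → ℝ) × Matrix (Fin d) (Fin d) ℝ) :
    ‖relativeParameters B c p - relativeParameters B c q‖ ^ 2 =
      ∑ i, (B *ᵥ (p.1 - c) - B *ᵥ (q.1 - c)) i ^ 2 +
        ∑ i, ∑ j, (B * p.2 * Bᵀ - B * q.2 * Bᵀ) i j ^ 2 := by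
  rw [EuclideanSpace.norm_sq_eq, Fintype.sum_sum_type, Fintype.sum_prod_type]
  simp [relativeParameters]

/-- A set of Gaussians pairwise more than `α` apart in total variation has few elements within
distance `γ` of a given Gaussian. -/
theorem card_le_of_tvDist_separated {d : ℕ} {α γ : ℝ} (hα : 0 < α) (hαγ : α < γ)
    (hγ : γ ≤ 1 / 600) (c : Fin d → ℝ) {S : Matrix (Fin d) (Fin d) ℝ} (hS : S.PosDef)
    (F : Finset ((Fin d → ℝ) × Matrix (Fin d) (Fin d) ℝ)) (hF : ∀ p ∈ F, p.2.PosDef)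
    (hFγ : ∀ p ∈ F, tvDist (gaussianMeasure d c S) (gaussianMeasure d p.1 p.2) ≤ γ)
    (hFα : ∀ p ∈ F, ∀ q ∈ F, p ≠ q →
      α < tvDist (gaussianMeasure d p.1 p.2) (gaussianMeasure d q.1 q.2)) :
    (F.card : ℝ) ≤ (1 + 1384 * γ / α) ^ (d + d * d) := by
  classical
  obtain ⟨B, hdet, hB⟩ := hS.exists_whitening
  have hlow : ∀ p ∈ F, ∑ i, (B *ᵥ (p.1 - c)) i ^ 2 ≤ (3 * (2 * γ)) ^ 2 ∧
      ∑ i, ∑ j, (B * p.2 * Bᵀ - 1) i j ^ 2 ≤ (86 * (2 * γ)) ^ 2 := by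
    intro p hp
    refine parameters_le_of_integral_abs_sub_le _ (posDef_conj (hF p hp) B hdet) _
      (by linarith) ?_
    have h1 := integral_abs_sub_gaussianDensity_affine B hdet c c p.1 S p.2
    rw [sub_self, Matrix.mulVec_zero, hB] at h1
    rw [h1]
    exact (integral_abs_sub_le_two_mul_tvDist c p.1 hS (hF p hp)).trans (by linarith [hFγ p hp])
  have hsep : ∀ p ∈ F, ∀ q ∈ F, p ≠ q →
      2 * (α / 8) ≤ ‖relativeParameters B c p - relativeParameters B c q‖ := by
    intro p hp q hq hpq
    by_contra! hlt
    have hsq : ‖relativeParameters B c p - relativeParameters B c q‖ ^ 2 ≤ (α / 4) ^ 2 := by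
      gcongr; linarith
    rw [norm_relativeParameters_sub_sq] at hsq
    have h1 := integral_abs_sub_gaussianDensity_le (B *ᵥ (q.1 - c)) (B *ᵥ (p.1 - c))
      (posDef_conj (hF q hq) B hdet) (posDef_conj (hF p hp) B hdet)
      ((hlow q hq).2.trans (by nlinarith)) (α / 4) (by positivity) (by linarith) hsq
    rw [integral_abs_sub_gaussianDensity_affine B hdet] at h1
    have h2 := tvDist_gaussianMeasure_le q.1 p.1 (hF q hq) (hF p hp)
    linarith [hFα q hq p hp hpq.symm]
  have hinj : Set.InjOn (relativeParameters B c) F := by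
    intro p hp q hq hpq
    by_contra hne
    have := hsep p hp q hq hne
    rw [hpq, sub_self, norm_zero] at this
    linarith
  have hcard := card_mul_pow_le_of_separated (F.image (relativeParameters B c))
    (r := 173 * γ) (δ := α / 8) (by linarith) (by positivity)
    (by
      intro x hx
      obtain ⟨p, hp, rfl⟩ := Finset.mem_image.1 hx
      refine abs_le_of_sq_le_sq' ?_ (by linarith) |>.2
      rw [norm_relativeParameters_sq]
      nlinarith [hlow p hp, sq_nonneg γ])
    (by
      intro x hx y hy hxy
      obtain ⟨p, hp, rfl⟩ := Finset.mem_image.1 hx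
      obtain ⟨q, hq, rfl⟩ := Finset.mem_image.1 hy
      exact hsep p hp q hq fun h => hxy (by rw [h]))
  rw [Finset.card_image_of_injOn hinj, finrank_euclideanSpace] at hcard
  simp only [Fintype.card_sum, Fintype.card_fin, Fintype.card_prod] at hcard
  rw [← le_div_iff₀ (by positivity), ← div_pow] at hcard
  have hratio : (173 * γ + α / 8) / (α / 8) = 1 + 1384 * γ / α := by
    field_simp
    ring
  rwa [hratio] at hcard

theorem one_add_mul_div_pow_le {d : ℕ} (hd : 1 ≤ d) {α γ : ℝ} (hα : 0 < α) (hαγ : α < γ) :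
    (1 + 1384 * γ / α) ^ (d + d * d) ≤ (2 * γ / α) ^ ((22 : ℝ) * (d : ℝ) ^ 2) := by
  have hx : 1 < γ / α := (one_lt_div hα).2 hαγ
  have e1 : 1384 * γ / α = 1384 * (γ / α) := by ring
  have e2 : 2 * γ / α = 2 * (γ / α) := by ring
  rw [e1, e2]
  set x := γ / α
  have hbase : 1 + 1384 * x ≤ (2 * x) ^ 11 := by
    have h1 : 1 ≤ x ^ 10 := one_le_pow₀ hx.le
    have : (2 * x) ^ 11 = 2048 * (x ^ 10 * x) := by ring
    rw [this]
    nlinarith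
  have e3 : (22 : ℝ) * (d : ℝ) ^ 2 = ((11 * (2 * d ^ 2) : ℕ) : ℝ) := by push_cast; ring
  rw [e3, Real.rpow_natCast, pow_mul]
  calc (1 + 1384 * x) ^ (d + d * d) ≤ ((2 * x) ^ 11) ^ (d + d * d) := by gcongr
    _ ≤ ((2 * x) ^ 11) ^ (2 * d ^ 2) := by
        refine pow_le_pow_right₀ (one_le_pow₀ (by linarith)) ?_
        nlinarith

end Cover

theorem gaussians_locally_small_cover :
    ∃ C : ℝ, 0 < C ∧
      ∀ (d : ℕ), 1 ≤ d →
      ∀ (α γ : ℝ), 0 < α → α < γ → γ ≤ 1 / 600 →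
      ∃ 𝒞 : Set ((Fin d → ℝ) × Matrix (Fin d) (Fin d) ℝ),
        (∀ p ∈ 𝒞, p.2.PosDef) ∧
        (∀ (μhat : Fin d → ℝ) (Shat : Matrix (Fin d) (Fin d) ℝ), Shat.PosDef →
          ∃ p ∈ 𝒞, tvDist (gaussianMeasure d μhat Shat) (gaussianMeasure d p.1 p.2) ≤ α) ∧
        (∀ (μhat : Fin d → ℝ) (Shat : Matrix (Fin d) (Fin d) ℝ), Shat.PosDef →
          ({p ∈ 𝒞 | tvDist (gaussianMeasure d μhat Shat)
              (gaussianMeasure d p.1 p.2) ≤ γ}).Finite ∧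
          (({p ∈ 𝒞 | tvDist (gaussianMeasure d μhat Shat)
              (gaussianMeasure d p.1 p.2) ≤ γ}).ncard : ℝ)
            ≤ (2 * γ / α) ^ (C * (d : ℝ) ^ 2)) := by
  refine ⟨22, by norm_num, fun d hd α γ hα hαγ hγ => ?_⟩
  obtain ⟨𝒞, h𝒞⟩ := zorn_subset
    {T : Set ((Fin d → ℝ) × Matrix (Fin d) (Fin d) ℝ) | (∀ p ∈ T, p.2.PosDef) ∧
      T.Pairwise fun p q => α < tvDist (gaussianMeasure d p.1 p.2) (gaussianMeasure d q.1 q.2)}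
    (by
      intro c hc hchain
      refine ⟨⋃₀ c, ⟨?_, ?_⟩, fun s hs => Set.subset_sUnion_of_mem hs⟩
      · rintro p ⟨T, hT, hp⟩
        exact (hc hT).1 p hp
      · exact (Set.pairwise_sUnion hchain.directedOn).2 fun T hT => (hc hT).2)
  obtain ⟨hpos, hsep⟩ := h𝒞.prop
  have hsep' : ∀ p ∈ 𝒞, ∀ q ∈ 𝒞, p ≠ q →
      α < tvDist (gaussianMeasure d p.1 p.2) (gaussianMeasure d q.1 q.2) :=
    fun p hp q hq hpq => hsep hp hq hpq
  refine ⟨𝒞, hpos, fun c S hS => ?_, fun c S hS => ?_⟩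
  · by_contra! hfar
    have hins : insert (c, S) 𝒞 ⊆ 𝒞 := by
      refine h𝒞.le_of_ge ⟨?_, ?_⟩ (Set.subset_insert _ _)
      · rintro p (rfl | hp)
        · exact hS
        · exact hpos p hp
      · refine hsep.insert fun q hq _ => ⟨hfar q hq, ?_⟩
        rw [tvDist_comm]
        exact hfar q hq
    have := hfar _ (hins (Set.mem_insert _ _))
    rw [tvDist_self] at this
    linarith
  · set A := {p ∈ 𝒞 | tvDist (gaussianMeasure d c S) (gaussianMeasure d p.1 p.2) ≤ γ} with hA
    have hcard : ∀ F : Finset ((Fin d → ℝ) × Matrix (Fin d) (Fin d) ℝ), (F : Set _) ⊆ A →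
        (F.card : ℝ) ≤ (1 + 1384 * γ / α) ^ (d + d * d) := fun F hF =>
      card_le_of_tvDist_separated hα hαγ hγ c hS F (fun p hp => hpos p (hF hp).1)
        (fun p hp => (hF hp).2) fun p hp q hq hpq => hsep' p (hF hp).1 q (hF hq).1 hpq
    have hfin : A.Finite := by
      by_contra hinf
      obtain ⟨n, hn⟩ := exists_nat_gt ((1 + 1384 * γ / α) ^ (d + d * d))
      obtain ⟨F, hF, hFn⟩ := Set.Infinite.exists_subset_card_eq hinf n
      have := hcard F hF
      rw [hFn] at this
      linarith
    refine ⟨hfin, ?_⟩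
    rw [Set.ncard_eq_toFinset_card A hfin]
    exact (hcard hfin.toFinset (by simp)).trans (one_add_mul_div_pow_le hd hα hαγ)
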